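/- Let n ≥ 3. The orthogonal group O(n) has exactly two path components: the set of path components of the topological space O(n) (the zeroth homotopy, i.e., the quotient of O(n) by the relation of being joined by a path) has exactly two elements. -/

import Mathlib

open Matrix

namespace Matrix

theorem dotProduct_self_of_mem_sphere {n : Type*} [Fintype n]
    (v : Metric.sphere (0 : EuclideanSpace ℝ n) 1) : v.1.ofLp ⬝ᵥ v.1.ofLp = 1 := by
  have h := EuclideanSpace.real_norm_sq_eq v.1
  rw [norm_eq_of_mem_sphere v] at h
  simpa [dotProduct, sq] using h.symm

variable {n : Type*} [Fintype n] [DecidableEq n]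

/-- The matrix of the reflection in the hyperplane orthogonal to a unit vector. -/
def householder (v : Metric.sphere (0 : EuclideanSpace ℝ n) 1) : orthogonalGroup n ℝ :=
  ⟨1 - (2 : ℝ) • vecMulVec v.1.ofLp v.1.ofLp, by
    have hv := dotProduct_self_of_mem_sphere v
    rw [mem_orthogonalGroup_iff']
    simp only [transpose_sub, transpose_one, transpose_smul, transpose_vecMulVec]
    simp only [mul_sub, sub_mul, mul_one, one_mul, smul_mul_assoc, mul_smul_comm,
      vecMulVec_mul_vecMulVec, hv, one_smul]
    module⟩

theorem coe_householder (v : Metric.sphere (0 : EuclideanSpace ℝ n) 1) :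
    (householder v : Matrix n n ℝ) = 1 - (2 : ℝ) • vecMulVec v.1.ofLp v.1.ofLp :=
  rfl

theorem continuous_householder : Continuous (householder (n := n)) := by
  refine Continuous.subtype_mk ?_ _
  fun_prop

theorem toEuclideanCLM_householder_apply (v : Metric.sphere (0 : EuclideanSpace ℝ n) 1)
    (x : EuclideanSpace ℝ n) :
    toEuclideanCLM (𝕜 := ℝ) (householder v : Matrix n n ℝ) x = (ℝ ∙ v.1)ᗮ.reflection x := by
  rw [Submodule.reflection_orthogonal_apply, Submodule.reflection_singleton_apply,
    norm_eq_of_mem_sphere v]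
  ext i
  simp [coe_householder, vecMulVec_mulVec,
    EuclideanSpace.inner_eq_star_dotProduct, dotProduct_comm]
  ring

theorem householder_mul_self (v : Metric.sphere (0 : EuclideanSpace ℝ n) 1) :
    householder v * householder v = 1 := by
  apply Subtype.ext
  apply EquivLike.injective (toEuclideanCLM (n := n) (𝕜 := ℝ))
  ext1 x
  simp [toEuclideanCLM_householder_apply]

theorem det_householder (v : Metric.sphere (0 : EuclideanSpace ℝ n) 1) :
    (householder v : Matrix n n ℝ).det = -1 := by
  have hv := dotProduct_self_of_mem_sphere v
  have h := det_one_add_replicateCol_mul_replicateRow (ι := Unit) (-(2 : ℝ) • v.1.ofLp) v.1.ofLp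
  rw [← vecMulVec_eq, dotProduct_smul, hv, smul_vecMulVec, neg_smul, ← sub_eq_add_neg] at h
  rw [coe_householder, h]
  norm_num

theorem joined_householder (hn : 1 < Fintype.card n)
    (v w : Metric.sphere (0 : EuclideanSpace ℝ n) 1) : Joined (householder v) (householder w) := by
  have hr : 1 < Module.rank ℝ (EuclideanSpace ℝ n) := by
    rw [← Module.finrank_eq_rank, finrank_euclideanSpace]
    exact_mod_cast hn
  have := isPathConnected_iff_pathConnectedSpace.mp
    (isPathConnected_sphere hr (0 : EuclideanSpace ℝ n) zero_le_one)
  exact (PathConnectedSpace.joined v w).map continuous_householder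

/-- Every product of hyperplane reflections is represented by an orthogonal matrix in the path
component of the identity or of a fixed reflection. -/
theorem exists_joined_toEuclideanCLM_eq_prod (hn : 1 < Fintype.card n)
    (e : Metric.sphere (0 : EuclideanSpace ℝ n) 1) (l : List (EuclideanSpace ℝ n)) :
    ∃ A : orthogonalGroup n ℝ, (Joined A 1 ∨ Joined A (householder e)) ∧
      ∀ x, toEuclideanCLM (𝕜 := ℝ) (A : Matrix n n ℝ) x =
        (l.map fun v ↦ (ℝ ∙ v)ᗮ.reflection).prod x := by
  induction l with
  | nil => exact ⟨1, .inl (.refl _), by simp⟩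
  | cons v l ih =>
    obtain ⟨A, hA, hAl⟩ := ih
    by_cases hv : v = 0
    · refine ⟨A, hA, fun x ↦ ?_⟩
      subst hv
      rw [hAl, List.map_cons, List.prod_cons, LinearIsometryEquiv.coe_mul, Function.comp_apply,
        Submodule.reflection_orthogonal_apply, Submodule.reflection_singleton_apply]
      simp
    · let u : Metric.sphere (0 : EuclideanSpace ℝ n) 1 :=
        ⟨‖v‖⁻¹ • v, by simp [norm_smul, hv]⟩
      have hu : (ℝ ∙ u.1) = ℝ ∙ v :=
        Submodule.span_singleton_smul_eq (by simpa using hv) v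
      refine ⟨householder u * A, ?_, fun x ↦ ?_⟩
      · have hue := joined_householder hn u e
        rcases hA with hA | hA
        · exact .inr (by simpa using hue.mul hA)
        · exact .inl (by simpa [householder_mul_self] using hue.mul hA)
      · simp only [Submonoid.coe_mul, map_mul, mul_apply_eq_comp, hAl,
          toEuclideanCLM_householder_apply, List.map_cons, List.prod_cons,
          LinearIsometryEquiv.coe_mul, Function.comp_apply, hu]

theorem joined_one_or_joined_householder (hn : 1 < Fintype.card n)
    (e : Metric.sphere (0 : EuclideanSpace ℝ n) 1) (A : orthogonalGroup n ℝ) :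
    Joined A 1 ∨ Joined A (householder e) := by
  let φ := Unitary.linearIsometryEquiv
    ⟨toEuclideanCLM (𝕜 := ℝ) (A : Matrix n n ℝ), Unitary.map_mem toEuclideanCLM A.2⟩
  obtain ⟨l, -, hl⟩ := φ.reflections_generate_dim
  obtain ⟨B, hB, hBl⟩ := exists_joined_toEuclideanCLM_eq_prod hn e l
  have hAB : A = B := by
    apply Subtype.ext
    apply EquivLike.injective (toEuclideanCLM (n := n) (𝕜 := ℝ))
    ext1 x
    rw [hBl, ← hl]
    rfl
  exact hAB ▸ hB

theorem det_eq_of_joined {A B : {A : Matrix n n ℝ // Aᵀ * A = 1}} (h : Joined A B) :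
    A.1.det = B.1.det := by
  have hdet (C : {A : Matrix n n ℝ // Aᵀ * A = 1}) : C.1.det = 1 ∨ C.1.det = -1 := by
    have hC := congrArg det C.2
    rw [det_mul, det_transpose, det_one] at hC
    exact mul_self_eq_one_iff.mp hC
  have hc : Continuous fun C : {A : Matrix n n ℝ // Aᵀ * A = 1} ↦ C.1.det :=
    continuous_subtype_val.matrix_det
  have key {C D : {A : Matrix n n ℝ // Aᵀ * A = 1}} (hCD : Joined C D) (hC : C.1.det = 1) :
      D.1.det ≠ -1 := by
    intro hD
    obtain ⟨γ⟩ := hCD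
    obtain ⟨t, ht⟩ := mem_range_of_exists_le_of_exists_ge (hc.comp γ.continuous) (c := 0)
      ⟨1, by simp [hD]⟩ ⟨0, by simp [hC]⟩
    rcases hdet (γ t) with h | h <;> simp [h] at ht
  rcases hdet A with hA | hA <;> rcases hdet B with hB | hB
  · rw [hA, hB]
  · exact (key h hA hB).elim
  · exact (key h.symm hB hA).elim
  · rw [hA, hB]

end Matrix

theorem stmt_12 (n : ℕ) (hn : 3 ≤ n) :
    Nat.card (ZerothHomotopy {A : Matrix (Fin n) (Fin n) ℝ // Aᵀ * A = 1}) = 2 := by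
  have hcard : 1 < Fintype.card (Fin n) := by rw [Fintype.card_fin]; omega
  let e : Metric.sphere (0 : EuclideanSpace ℝ (Fin n)) 1 :=
    ⟨EuclideanSpace.single ⟨0, by omega⟩ 1, by simp⟩
  let f : orthogonalGroup (Fin n) ℝ → {A : Matrix (Fin n) (Fin n) ℝ // Aᵀ * A = 1} :=
    fun A ↦ ⟨A.1, (mem_orthogonalGroup_iff' _ _).mp A.2⟩
  have hf : Continuous f := continuous_subtype_val.subtype_mk _
  refine Nat.card_eq_two_iff.mpr
    ⟨Quotient.mk _ (f 1), Quotient.mk _ (f (householder e)), fun h ↦ ?_, ?_⟩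
  · have hdet : (1 : Matrix (Fin n) (Fin n) ℝ).det = (householder e).1.det :=
      det_eq_of_joined (Quotient.exact h)
    rw [det_householder, det_one] at hdet
    norm_num at hdet
  · refine Set.eq_univ_of_forall fun x ↦ ?_
    induction x using Quotient.inductionOn with
    | h A =>
      rcases joined_one_or_joined_householder hcard e
        ⟨A.1, (mem_orthogonalGroup_iff' _ _).mpr A.2⟩ with h | h
      · exact .inl (Quotient.sound (h.map hf))
      · exact .inr (Quotient.sound (h.map hf))
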